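/- arXiv:1212.6533 — 4 statements merged into one kernel-verified Lean document; each statement's English description precedes it below -/
import Mathlib

section
/- Let n ≥ 1, let k₀ ∈ ZMod n, and let m : ZMod n → ℤ satisfy: m(k₀−1) + m(k₀+1) − 2·m(k₀) ≥ −1, and m(k−1) + m(k+1) − 2·m(k) ≥ 0 for every k ≠ k₀. Then m is constant. -/
/-- Integers summing to zero that all lie in `{c, c + 1}` vanish. -/
lemma eq_zero_of_sum_eq_zero_of_le_of_le_add_one {ι : Type*} [Fintype ι] {f : ι → ℤ} {c : ℤ}
    (hsum : ∑ i, f i = 0) (hc : ∀ i, c ≤ f i) (hc' : ∀ i, f i ≤ c + 1) (i : ι) : f i = 0 := by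
  rcases le_or_gt 0 c with h | h
  · exact (Finset.sum_eq_zero_iff_of_nonneg fun j _ => h.trans (hc j)).1 hsum i (Finset.mem_univ i)
  · exact (Finset.sum_eq_zero_iff_of_nonpos fun j _ => (hc' j).trans h).1 hsum i
      (Finset.mem_univ i)

/-- A function on `ZMod n` that does not decrease at any step `k - 1 ↦ k` with `k ≠ k₀` is
monotone along `k₀, k₀ + 1, …, k₀ + (n - 1)`. -/
lemma ZMod.le_of_step_le {n : ℕ} {α : Type*} [Preorder α] {k₀ : ZMod n} {d : ZMod n → α}
    (hd : ∀ k, k ≠ k₀ → d (k - 1) ≤ d k) {i j : ℕ} (hij : i ≤ j) (hj : j < n) :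
    d (k₀ + i) ≤ d (k₀ + j) := by
  induction j, hij using Nat.le_induction with
  | base => exact le_rfl
  | succ j _ ih =>
    refine (ih (by lia)).trans ?_
    have hne : k₀ + ((j + 1 : ℕ) : ZMod n) ≠ k₀ := by
      rw [Ne, add_eq_left, ZMod.natCast_eq_zero_iff]
      exact Nat.not_dvd_of_pos_of_lt j.succ_pos hj
    have hstep := hd _ hne
    rwa [Nat.cast_succ, ← add_assoc, add_sub_cancel_right, add_assoc, ← Nat.cast_succ] at hstep

/-- If the discrete Laplacian of `m : ZMod n → ℤ` is at least `-1` at `k₀` and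
nonnegative at every other index, then `m` is constant. -/
theorem stmt_1 (n : ℕ) (hn : 1 ≤ n) (k₀ : ZMod n) (m : ZMod n → ℤ)
    (h₀ : m (k₀ - 1) + m (k₀ + 1) - 2 * m k₀ ≥ -1)
    (h : ∀ k : ZMod n, k ≠ k₀ → m (k - 1) + m (k + 1) - 2 * m k ≥ 0) :
    ∀ j k : ZMod n, m j = m k := by
  have : NeZero n := ⟨by lia⟩
  let d : ZMod n → ℤ := fun k => m (k + 1) - m k
  have hd : ∀ k, k ≠ k₀ → d (k - 1) ≤ d k := fun k hk => by
    have := h k hk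
    simp only [d, sub_add_cancel]
    linarith
  have hd₀ : d (k₀ - 1) ≤ d k₀ + 1 := by
    simp only [d, sub_add_cancel]
    linarith
  have hval (k : ZMod n) : k₀ + ((k - k₀).val : ZMod n) = k := by
    rw [ZMod.natCast_zmod_val, add_sub_cancel]
  have hlast : k₀ + ((n - 1 : ℕ) : ZMod n) = k₀ - 1 := by
    rw [Nat.cast_sub hn, ZMod.natCast_self, Nat.cast_one, zero_sub, sub_eq_add_neg]
  have hlower (k : ZMod n) : d k₀ ≤ d k := by
    have := ZMod.le_of_step_le hd (Nat.zero_le _) (ZMod.val_lt (k - k₀))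
    rwa [hval, Nat.cast_zero, add_zero] at this
  have hupper (k : ZMod n) : d k ≤ d k₀ + 1 := by
    have := ZMod.le_of_step_le hd (Nat.le_sub_one_of_lt (ZMod.val_lt (k - k₀)))
      (show n - 1 < n by lia)
    rw [hval, hlast] at this
    exact this.trans hd₀
  have hsum : ∑ k, d k = 0 := by
    simp only [d, Finset.sum_sub_distrib]
    exact sub_eq_zero.2 (Equiv.sum_comp (Equiv.addRight (1 : ZMod n)) m)
  have hstep (k : ZMod n) : m (k + 1) = m k :=
    sub_eq_zero.1 (eq_zero_of_sum_eq_zero_of_le_of_le_add_one hsum hlower hupper k)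
  have hnat (i : ℕ) : m i = m 0 := by
    induction i with
    | zero => rw [Nat.cast_zero]
    | succ i ih => rw [Nat.cast_succ, hstep, ih]
  have hconst (k : ZMod n) : m k = m 0 := by
    simpa only [ZMod.natCast_zmod_val] using hnat k.val
  exact fun j k => (hconst j).trans (hconst k).symm
end

section
/- Let n ≥ 1 and let g : ZMod n → ℤ be a function with Σ_{k ∈ ZMod n} g(k) = 0. Then there exists m : ZMod n → ℤ whose discrete Laplacian equals g, i.e. m(k−1) + m(k+1) − 2·m(k) = g(k) for all k, if and only if Σ_{j=0}^{n−1} j·g(j) ≡ 0 (mod n), where the sum is taken over the canonical lifts j ∈ {0, 1, …, n−1} of the elements of ZMod n. -/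
theorem ZMod.sum_range_natCast {M : Type*} [AddCommMonoid M] (n : ℕ) [NeZero n]
    (f : ZMod n → M) : ∑ i ∈ Finset.range n, f (i : ZMod n) = ∑ k, f k :=
  Finset.sum_bij' (fun i _ => (i : ZMod n)) (fun k _ => k.val)
    (fun _ _ => Finset.mem_univ _)
    (fun k _ => Finset.mem_range.2 k.val_lt)
    (fun _ hi => ZMod.val_cast_of_lt (Finset.mem_range.1 hi))
    (fun k _ => ZMod.natCast_zmod_val k)
    (fun _ _ => rfl)

/-- A function on the cycle with total sum zero is a forward difference. -/
theorem ZMod.exists_forward_difference_eq {M : Type*} [AddCommGroup M] (n : ℕ) [NeZero n]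
    (f : ZMod n → M) (hf : ∑ k, f k = 0) :
    ∃ F : ZMod n → M, ∀ k, F (k + 1) - F k = f k := by
  refine ⟨fun k => ∑ i ∈ Finset.range k.val, f (i : ZMod n), fun k => ?_⟩
  have hk : ∑ i ∈ Finset.range (k + 1).val, f (i : ZMod n)
      = ∑ i ∈ Finset.range (k.val + 1), f (i : ZMod n) := by
    have hcast : k + 1 = ((k.val + 1 : ℕ) : ZMod n) := by simp
    rcases (Nat.succ_le_of_lt k.val_lt).lt_or_eq with h | h
    · rw [hcast, ZMod.val_cast_of_lt h]
    · have h' : k.val + 1 = n := h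
      have h0 : k + 1 = 0 := by rw [hcast, h', ZMod.natCast_self]
      rw [h0, h', ZMod.sum_range_natCast, hf]
      simp
  simp only [hk, Finset.sum_range_succ, ZMod.natCast_zmod_val]
  abel

theorem ZMod.sum_mul_forward_difference {n : ℕ} [NeZero n] (f : ZMod n → ZMod n) :
    ∑ k, k * (f (k + 1) - f k) = -∑ k, f k := by
  have h : ∑ k, (k + 1 - 1) * f (k + 1) = ∑ k, (k - 1) * f k :=
    Equiv.sum_comp (Equiv.addRight (1 : ZMod n)) fun k => (k - 1) * f k
  simp only [add_sub_cancel_right, sub_mul, one_mul, Finset.sum_sub_distrib] at h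
  simp only [mul_sub, Finset.sum_sub_distrib, h]
  ring

theorem ZMod.intCast_dvd_sum_val_mul_iff {n : ℕ} [NeZero n] (g : ZMod n → ℤ) :
    (n : ℤ) ∣ ∑ k : ZMod n, (k.val : ℤ) * g k ↔ ∑ k : ZMod n, k * (g k : ZMod n) = 0 := by
  rw [← ZMod.intCast_zmod_eq_zero_iff_dvd]
  simp

/-- The first moment of a forward difference is, modulo `n`, minus the total sum. -/
theorem ZMod.dvd_sum_val_mul_forward_difference_iff {n : ℕ} [NeZero n] (f : ZMod n → ℤ) :
    (n : ℤ) ∣ ∑ k : ZMod n, (k.val : ℤ) * (f (k + 1) - f k) ↔ (n : ℤ) ∣ ∑ k, f k := by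
  rw [ZMod.intCast_dvd_sum_val_mul_iff (fun k => f (k + 1) - f k),
    ← ZMod.intCast_zmod_eq_zero_iff_dvd]
  simp only [Int.cast_sub, Int.cast_sum]
  rw [ZMod.sum_mul_forward_difference fun k => (f k : ZMod n), neg_eq_zero]


/-- Solvability criterion for the discrete Poisson equation on the cycle `ZMod n`:
for `g` with total sum zero, there exists `m` whose discrete Laplacian is `g`
iff `n` divides `∑ j·g(j)`, the sum taken over canonical lifts `j ∈ {0,…,n-1}`. -/
theorem stmt_3 (n : ℕ) [NeZero n] (g : ZMod n → ℤ)
    (hsum : ∑ k : ZMod n, g k = 0) :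
    (∃ m : ZMod n → ℤ, ∀ k : ZMod n, m (k - 1) + m (k + 1) - 2 * m k = g k) ↔
      (n : ℤ) ∣ ∑ k : ZMod n, (k.val : ℤ) * g k := by
  constructor
  · rintro ⟨m, hm⟩
    have hg : ∀ k, g k = (m (k + 1) - m (k + 1 - 1)) - (m k - m (k - 1)) := fun k => by
      rw [add_sub_cancel_right, ← hm k]
      ring
    simp only [hg]
    rw [ZMod.dvd_sum_val_mul_forward_difference_iff fun k => m k - m (k - 1),
      Finset.sum_sub_distrib, ← Equiv.sum_comp (Equiv.subRight (1 : ZMod n)) m]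
    simp
  · intro h
    obtain ⟨e, he⟩ := ZMod.exists_forward_difference_eq n g hsum
    simp only [← he] at h
    obtain ⟨c, hc⟩ := (ZMod.dvd_sum_val_mul_forward_difference_iff e).1 h
    obtain ⟨m, hm⟩ := ZMod.exists_forward_difference_eq n (fun k => e k - c)
      (by simp [Finset.sum_sub_distrib, hc, ZMod.card])
    refine ⟨fun k => m (k + 1), fun k => ?_⟩
    have h₁ := hm k
    have h₂ := hm (k + 1)
    have h₃ := he k
    simp only [sub_add_cancel]
    linarith
end

section
/- Let n ≥ 2 and let c₁, c₂, c₃, c₄ and d₁, …, d_n be integers satisfying: d₁ − 2c₁ ≥ −1, d₁ − 2c₂ ≥ 0, d_n − 2c₃ ≥ 0, d_n − 2c₄ ≥ 0, c₁ + c₂ + d₂ − 2d₁ ≥ 0, d_{j−1} + d_{j+1} − 2d_j ≥ 0 for all 2 ≤ j ≤ n−1, and c₃ + c₄ + d_{n−1} − 2d_n ≥ 0. Then there exists an integer c with c₁ = c₂ = c₃ = c₄ = c and d_j = 2c for all 1 ≤ j ≤ n. -/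
/-- Numerical claim for a fiber of Kodaira type I*_n: the listed inequalities on
the multiplicities `c₁, c₂, c₃, c₄, d₁, …, d_n` force them to be proportional to
the fiber multiplicities `(1,1,1,1,2,…,2)`. -/
theorem stmt_4 (n : ℕ) (hn : 2 ≤ n) (c₁ c₂ c₃ c₄ : ℤ) (d : ℕ → ℤ)
    (h₁ : d 1 - 2 * c₁ ≥ -1) (h₂ : d 1 - 2 * c₂ ≥ 0)
    (h₃ : d n - 2 * c₃ ≥ 0) (h₄ : d n - 2 * c₄ ≥ 0)
    (h₅ : c₁ + c₂ + d 2 - 2 * d 1 ≥ 0)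
    (h₆ : ∀ j, 2 ≤ j → j ≤ n - 1 → d (j - 1) + d (j + 1) - 2 * d j ≥ 0)
    (h₇ : c₃ + c₄ + d (n - 1) - 2 * d n ≥ 0) :
    ∃ c : ℤ, c₁ = c ∧ c₂ = c ∧ c₃ = c ∧ c₄ = c ∧
      ∀ j, 1 ≤ j → j ≤ n → d j = 2 * c := by
  have up : ∀ k, k + 2 ≤ n → d (k + 1) ≤ d (k + 2) := by
    intro k
    induction k with
    | zero => intro _; simp only [Nat.zero_add]; omega
    | succ k ih =>
      intro hk
      have h := h₆ (k + 2) (by omega) (by omega)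
      rw [show k + 2 - 1 = k + 1 by omega] at h
      have := ih (by omega)
      rw [show k + 1 + 1 = k + 2 by omega, show k + 1 + 2 = k + 2 + 1 by omega]
      omega
  have down : ∀ k j, j + k + 1 = n → 1 ≤ j → d (j + 1) ≤ d j := by
    intro k
    induction k with
    | zero =>
      rintro j rfl _
      simp only [Nat.add_zero, Nat.add_sub_cancel] at *
      omega
    | succ k ih =>
      intro j hjk hj
      have h := h₆ (j + 1) (by omega) (by omega)
      rw [Nat.add_sub_cancel] at h
      have := ih (j + 1) (by omega) (by omega)
      omega
  have const : ∀ k, k + 1 ≤ n → d (k + 1) = d 1 := by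
    intro k
    induction k with
    | zero => intro _; rfl
    | succ k ih =>
      intro hk
      have hup := up k hk
      have hdown := down (n - (k + 2)) (k + 1) (by omega) (by omega)
      exact (le_antisymm hdown hup).trans (ih (by omega))
  have hd : ∀ j, 1 ≤ j → j ≤ n → d j = d 1 := by
    intro j hj hjn
    obtain ⟨k, rfl⟩ := Nat.exists_eq_add_of_le' hj
    exact const k hjn
  have hd2 := hd 2 (by omega) hn
  have hdn := hd n (by omega) le_rfl
  have hdn' := hd (n - 1) (by omega) (by omega)
  refine ⟨c₃, by omega, by omega, rfl, by omega, fun j hj hjn => ?_⟩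
  have := hd j hj hjn
  omega
end

section
/- Let M be a ℤ-module equipped with a symmetric ℤ-bilinear form B : M × M → ℤ. Let σ, f ∈ M satisfy B(σ,σ) = −2, B(f,f) = 0, B(σ,f) = 1, let ℓ ≥ 2 be an integer, and set H = σ + (ℓ+1)·f. Suppose F' = a·σ + R where a ∈ ℤ and R ∈ M satisfies B(R,f) = 0, B(R,R) ≤ 0, and the implication: if B(R,R) = 0 then R = m·f for some integer m. If B(F',F') = 0 and B(F',H) = 1, then F' = f. -/
/-- Lattice-theoretic uniqueness of the fiber class (Lemma 1 (iv)): in a ℤ-module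
with a symmetric bilinear form, with `σ² = -2`, `f² = 0`, `σ·f = 1`, `ℓ ≥ 2`,
`H = σ + (ℓ+1)f`, any `F' = aσ + R` with `R·f = 0`, `R² ≤ 0`, `R² = 0 → R ∈ ℤf`,
satisfying `F'² = 0` and `F'·H = 1`, must equal `f`. -/
theorem stmt_7 (M : Type*) [AddCommGroup M] [Module ℤ M]
    (B : LinearMap.BilinForm ℤ M) (hB : ∀ x y : M, B x y = B y x)
    (σ f : M) (hσσ : B σ σ = -2) (hff : B f f = 0) (hσf : B σ f = 1)
    (ℓ : ℤ) (hℓ : 2 ≤ ℓ) (H : M) (hH : H = σ + (ℓ + 1) • f)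
    (a : ℤ) (R F' : M) (hF' : F' = a • σ + R)
    (hRf : B R f = 0) (hRR : B R R ≤ 0)
    (hRzero : B R R = 0 → ∃ m : ℤ, R = m • f)
    (hFF : B F' F' = 0) (hFH : B F' H = 1) :
    F' = f := by
  obtain rfl : ‹Module ℤ M› = AddCommGroup.toIntModule M := Subsingleton.elim _ _
  subst hF' hH
  have hRσ := hB R σ
  simp only [map_add, map_smul, LinearMap.add_apply, LinearMap.smul_apply, smul_eq_mul,
    hσσ, hσf, hRf, hRσ] at hFF hFH
  have hs : B σ R = 1 - a * (ℓ - 1) := by linarith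
  rw [hs] at hFF
  have hle : a * (a * ℓ - 1) ≤ 0 := by nlinarith
  obtain rfl : a = 0 := by
    rcases lt_trichotomy a 0 with h | h | h
    · nlinarith [mul_pos_of_neg_of_neg h h]
    · exact h
    · nlinarith [mul_pos h h]
  obtain ⟨m, rfl⟩ := hRzero (by linarith)
  have hm : m = 1 := by simpa [hσf] using hs
  simp [hm]
end
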